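/- Let n, ℓ, r be positive integers, q = 2^r, m = 2^ℓ, with q ≥ m ≥ n ≥ 2. Let X ⊆ Z_q be a set of n elements. Choose a uniformly at random from the odd residues in Z_q (i.e., from Z_q^*) and define the random hash function h : Z_q → {0,1,...,m−1} by h(x) = ⌊ lift_q(a·x) · m / q ⌋, where lift_q : Z_q → {0,1,...,q−1} is the canonical representative. Let M = max over y ∈ {0,...,m−1} of |{x ∈ X : h(x) = y}|. Then there is an absolute constant C (independent of q, m, n and X) such that E[M] ≤ C · (n · log n)^(1/3). -/

import Mathlib

open Finset

/-- The weight of an ordered pair of distinct points of `Y` in a common fiber of `c`: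
the inverse of the size of that fiber. -/
noncomputable def fiberWeight {α : Type*} [DecidableEq α] (Y : Finset α) (c : α → ℕ)
    (x x' : α) : ℝ :=
  if x ∈ Y ∧ x' ∈ Y ∧ x ≠ x' ∧ c x = c x' then ((#{z ∈ Y | c z = c x} : ℕ) : ℝ)⁻¹ else 0

lemma sum_inv_card_fiber {α β : Type*} [DecidableEq β] (Y : Finset α) (c : α → β) :
    ∑ x ∈ Y, ((#{z ∈ Y | c z = c x} : ℕ) : ℝ)⁻¹ = #(Y.image c) := by
  rw [← Finset.sum_fiberwise_of_maps_to (t := Y.image c) (g := c)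
    (fun x hx => mem_image_of_mem c hx), Finset.card_eq_sum_ones, Nat.cast_sum]
  refine sum_congr rfl fun j hj => ?_
  obtain ⟨x, hx, rfl⟩ := mem_image.1 hj
  have h0 : ((#{z ∈ Y | c z = c x} : ℕ) : ℝ) ≠ 0 := by
    have : 0 < #{z ∈ Y | c z = c x} := card_pos.2 ⟨x, by simp [hx]⟩
    positivity
  rw [sum_congr rfl (g := fun _ => ((#{z ∈ Y | c z = c x} : ℕ) : ℝ)⁻¹)]
  · rw [sum_const, nsmul_eq_mul]; simp [h0]
  · intro z hz
    rw [(mem_filter.1 hz).2]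

lemma fiberWeight_nonneg {α : Type*} [DecidableEq α] (Y : Finset α) (c : α → ℕ) (x x' : α) :
    0 ≤ fiberWeight Y c x x' := by
  unfold fiberWeight; split_ifs <;> positivity

lemma le_sum_fiberWeight {α : Type*} [DecidableEq α] {X Y : Finset α} (hYX : Y ⊆ X) {c : α → ℕ}
    {w : ℕ} (hc : ∀ x ∈ Y, c x < w) :
    (#Y : ℝ) - w ≤ ∑ x ∈ X, ∑ x' ∈ X, fiberWeight Y c x x' := by
  have h1 : ∀ x ∈ Y, ∑ x' ∈ X, fiberWeight Y c x x' = 1 - ((#{z ∈ Y | c z = c x} : ℕ) : ℝ)⁻¹ := by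
    intro x hx
    have hpos : 0 < #{z ∈ Y | c z = c x} := card_pos.2 ⟨x, by simp [hx]⟩
    have hset : {x' ∈ X | x ∈ Y ∧ x' ∈ Y ∧ x ≠ x' ∧ c x = c x'} = {z ∈ Y | c z = c x}.erase x := by
      ext z
      simp only [mem_filter, mem_erase]
      constructor
      · rintro ⟨_, _, h1, h2, h3⟩; exact ⟨h2.symm, h1, h3.symm⟩
      · rintro ⟨h2, h1, h3⟩; exact ⟨hYX h1, hx, h1, h2.symm, h3.symm⟩
    unfold fiberWeight
    rw [← sum_filter, sum_const, hset, card_erase_of_mem (by simp [hx]), nsmul_eq_mul,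
      Nat.cast_sub hpos]
    have : ((#{z ∈ Y | c z = c x} : ℕ) : ℝ) ≠ 0 := by positivity
    field_simp
    simp
  calc (#Y : ℝ) - w ≤ #Y - #(Y.image c) := by
        have : #(Y.image c) ≤ w := by
          calc _ ≤ #(range w) := card_le_card fun j hj => by
                obtain ⟨x, hx, rfl⟩ := mem_image.1 hj
                exact mem_range.2 (hc x hx)
            _ = w := card_range w
        have : (#(Y.image c) : ℝ) ≤ w := by exact_mod_cast this
        linarith
    _ = ∑ x ∈ Y, ∑ x' ∈ X, fiberWeight Y c x x' := by
        rw [sum_congr rfl h1, sum_sub_distrib, sum_inv_card_fiber]; simp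
    _ ≤ _ := sum_le_sum_of_subset_of_nonneg hYX fun x _ _ =>
        sum_nonneg fun x' _ => fiberWeight_nonneg Y c x x'

lemma sum_fiberWeight_mul_le {α : Type*} [DecidableEq α] (X Y Y' : Finset α) (c c' : α → ℕ) :
    ∑ x ∈ X, ∑ x' ∈ X, fiberWeight Y c x x' * fiberWeight Y' c' x x'
      ≤ #((Y ∩ Y').image fun x => (c x, c' x)) := by
  have key : ∀ x ∈ X, ∑ x' ∈ X, fiberWeight Y c x x' * fiberWeight Y' c' x x' ≤
      if x ∈ Y ∩ Y' then ((#{z ∈ Y ∩ Y' | (c z, c' z) = (c x, c' x)} : ℕ) : ℝ)⁻¹ else 0 := by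
    intro x _
    split_ifs with hx
    · obtain ⟨hxY, hxY'⟩ := mem_inter.1 hx
      set t := #{z ∈ Y ∩ Y' | (c z, c' z) = (c x, c' x)} with ht
      set s := #{z ∈ Y | c z = c x} with hs
      set s' := #{z ∈ Y' | c' z = c' x} with hs'
      have htpos : 0 < t := card_pos.2 ⟨x, by simp [hxY, hxY']⟩
      have hts : t ≤ s := card_le_card fun z hz => by
        simp only [mem_filter, mem_inter, Prod.mk.injEq] at hz ⊢; tauto
      have hts' : t ≤ s' := card_le_card fun z hz => by
        simp only [mem_filter, mem_inter, Prod.mk.injEq] at hz ⊢; tauto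
      have hR : (0 : ℝ) < t := by exact_mod_cast htpos
      have h1 : (t : ℝ) ≤ s := by exact_mod_cast hts
      have h2 : (t : ℝ) ≤ s' := by exact_mod_cast hts'
      calc ∑ x' ∈ X, fiberWeight Y c x x' * fiberWeight Y' c' x x'
          ≤ ∑ x' ∈ X, if x' ∈ ({z ∈ Y ∩ Y' | (c z, c' z) = (c x, c' x)} : Finset α)
              then (s : ℝ)⁻¹ * (s' : ℝ)⁻¹ else 0 := by
            refine sum_le_sum fun z _ => ?_
            unfold fiberWeight
            by_cases h1 : x ∈ Y ∧ z ∈ Y ∧ x ≠ z ∧ c x = c z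
            · by_cases h2 : x ∈ Y' ∧ z ∈ Y' ∧ x ≠ z ∧ c' x = c' z
              · rw [if_pos h1, if_pos h2,
                  if_pos (mem_filter.2 ⟨mem_inter.2 ⟨h1.2.1, h2.2.1⟩,
                    Prod.ext h1.2.2.2.symm h2.2.2.2.symm⟩)]
              · rw [if_neg h2, mul_zero]
                split_ifs <;> positivity
            · rw [if_neg h1, zero_mul]
              split_ifs <;> positivity
        _ ≤ t * ((s : ℝ)⁻¹ * (s' : ℝ)⁻¹) := by
            rw [← sum_filter, sum_const, nsmul_eq_mul]
            gcongr
            exact card_le_card fun z hz => (mem_filter.1 hz).2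
        _ ≤ t * ((t : ℝ)⁻¹ * (t : ℝ)⁻¹) := by gcongr
        _ = (t : ℝ)⁻¹ := by field_simp
    · refine (sum_eq_zero fun z _ => ?_).le
      rw [mem_inter, not_and_or] at hx
      rcases hx with hx | hx <;> simp [fiberWeight, hx]
  calc _ ≤ _ := sum_le_sum key
    _ ≤ ∑ x ∈ Y ∩ Y', ((#{z ∈ Y ∩ Y' | (c z, c' z) = (c x, c' x)} : ℕ) : ℝ)⁻¹ := by
        rw [← sum_filter]
        refine sum_le_sum_of_subset_of_nonneg (fun z hz => (mem_filter.1 hz).2) ?_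
        intros; positivity
    _ = _ := sum_inv_card_fiber _ _

lemma card_le_gcd {w w' : ℕ} (hw : 0 < w) (I : Finset (ℕ × ℕ))
    (hI : ∀ p ∈ I, p.1 < w)
    (h : ∀ p ∈ I, ∀ p' ∈ I, (w' : ℤ) * ((p.1 : ℤ) - p'.1) = w * ((p.2 : ℤ) - p'.2)) :
    #I ≤ Nat.gcd w w' := by
  set g := Nat.gcd w w' with hg
  have hgpos : 0 < g := Nat.gcd_pos_of_pos_left _ hw
  obtain ⟨u, hu⟩ : g ∣ w := Nat.gcd_dvd_left w w'
  obtain ⟨u', hu'⟩ : g ∣ w' := Nat.gcd_dvd_right w w'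
  have hupos : 0 < u := Nat.pos_of_ne_zero (by rintro rfl; omega)
  have hcop : IsCoprime (u : ℤ) u' := by
    rw [Nat.isCoprime_iff_coprime]
    have := Nat.coprime_div_gcd_div_gcd (m := w) (n := w') hgpos
    rw [← hg] at this
    rwa [hu, hu', Nat.mul_div_cancel_left _ hgpos, Nat.mul_div_cancel_left _ hgpos] at this
  rw [← card_range g]
  refine card_le_card_of_injOn (fun p => p.1 / u) (fun p hp => ?_) ?_
  · have := hI p hp
    simp only [coe_range, Set.mem_Iio]
    exact Nat.div_lt_of_lt_mul (by rw [mul_comm, ← hu]; exact this)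
  · intro p hp p' hp' hpp
    have e := h p hp p' hp'
    rw [hu, hu'] at e
    push_cast at e
    have e2 : (u' : ℤ) * ((p.1 : ℤ) - p'.1) = u * ((p.2 : ℤ) - p'.2) := by
      have : (g : ℤ) ≠ 0 := by positivity
      apply mul_left_cancel₀ this
      linarith
    have hd : (u : ℤ) ∣ (p.1 : ℤ) - p'.1 := by
      apply hcop.dvd_of_dvd_mul_left
      exact ⟨_, e2⟩
    have h1 : p.1 = p'.1 := by
      have hm : p'.1 % u = p.1 % u := (Nat.modEq_iff_dvd.2 hd)
      simp only at hpp
      rw [← Nat.div_add_mod p.1 u, ← Nat.div_add_mod p'.1 u, hpp, hm]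
    have h2 : p.2 = p'.2 := by
      rw [h1, sub_self, mul_zero] at e2
      have : (u : ℤ) ≠ 0 := by positivity
      have := (mul_eq_zero.1 e2.symm).resolve_left this
      omega
    exact Prod.ext h1 h2

lemma sum_gcd_le (N : ℕ) :
    (∑ w ∈ Icc 1 N, ∑ w' ∈ Icc 1 N, (Nat.gcd w w' : ℝ)) ≤ N ^ 2 * (1 + Real.log N) := by
  have hN : ∀ w ∈ Icc 1 N, ∀ w' ∈ Icc 1 N, (Nat.gcd w w' : ℝ) ≤
      ∑ d ∈ Icc 1 N, if d ∣ w ∧ d ∣ w' then (d : ℝ) else 0 := by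
    intro w hw w' _
    have hw := mem_Icc.1 hw
    have hmem : Nat.gcd w w' ∈ Icc 1 N := mem_Icc.2
      ⟨Nat.gcd_pos_of_pos_left _ (by omega), (Nat.gcd_le_left _ (by omega)).trans hw.2⟩
    refine le_trans ?_ (single_le_sum (f := fun d : ℕ => if d ∣ w ∧ d ∣ w' then (d : ℝ) else 0)
      (fun d _ => by split_ifs <;> positivity) hmem)
    simp [Nat.gcd_dvd_left, Nat.gcd_dvd_right]
  calc _ ≤ ∑ w ∈ Icc 1 N, ∑ w' ∈ Icc 1 N,
        ∑ d ∈ Icc 1 N, if d ∣ w ∧ d ∣ w' then (d : ℝ) else 0 :=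
        sum_le_sum fun w hw => sum_le_sum fun w' hw' => hN w hw w' hw'
    _ = ∑ d ∈ Icc 1 N, (d : ℝ) * (#{w ∈ Icc 1 N | d ∣ w} : ℝ) ^ 2 := by
        rw [sum_congr rfl fun w _ => sum_comm, sum_comm]
        refine sum_congr rfl fun d _ => ?_
        have : ∀ w w' : ℕ, (if d ∣ w ∧ d ∣ w' then (d : ℝ) else 0)
            = d * ((if d ∣ w then 1 else 0) * (if d ∣ w' then 1 else 0)) := by
          intro w w'; by_cases h : d ∣ w <;> by_cases h' : d ∣ w' <;> simp [h, h']
        simp_rw [this, ← mul_sum, ← sum_mul]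
        simp [sq]
    _ ≤ ∑ d ∈ Icc 1 N, (N : ℝ) ^ 2 * (d : ℝ)⁻¹ := by
        refine sum_le_sum fun d hd => ?_
        have hd := mem_Icc.1 hd
        have hd0 : (0 : ℝ) < d := by exact_mod_cast (by omega : 0 < d)
        have hc : #{w ∈ Icc 1 N | d ∣ w} = N / d := Nat.Ioc_filter_dvd_card_eq_div N d
        have : ((N / d : ℕ) : ℝ) ≤ N / d := Nat.cast_div_le
        rw [hc]
        calc (d : ℝ) * ((N / d : ℕ) : ℝ) ^ 2 ≤ d * ((N : ℝ) / d) ^ 2 := by gcongr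
          _ = _ := by field_simp
    _ ≤ _ := by
        rw [← mul_sum]
        have := harmonic_le_one_add_log N
        rw [harmonic_eq_sum_Icc] at this
        push_cast at this
        gcongr

lemma card_isUnit_mul_val_lt {r : ℕ} {d : ZMod (2 ^ r)} (hd : d ≠ 0) (S L : ℕ) (hS : 0 < S) :
    #{b : ZMod (2 ^ r) | IsUnit b ∧ S * (b * d).val < L} * S ≤ L := by
  have hd0 : d.val ≠ 0 := by rwa [Ne, ZMod.val_eq_zero]
  obtain ⟨i, v, hv, hdv⟩ := Nat.exists_eq_two_pow_mul_odd hd0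
  have hlt := ZMod.val_lt d
  have hir : i < r := by
    have : 2 ^ i ≤ d.val := by rw [hdv]; exact Nat.le_mul_of_pos_right _ hv.pos
    exact (Nat.pow_lt_pow_iff_right (by norm_num)).1 (this.trans_lt hlt)
  obtain ⟨s, rfl⟩ : ∃ s, r = s + 1 + i := ⟨r - i - 1, by omega⟩
  have hu : IsUnit ((v : ℕ) : ZMod (2 ^ (s + 1 + i))) := by
    rw [ZMod.isUnit_iff_coprime]
    exact (Nat.coprime_pow_right_iff (by omega) _ _).2 (Nat.coprime_two_right.2 hv)
  have hdeq : d = (v : ZMod (2 ^ (s + 1 + i))) * ((2 ^ i : ℕ) : ZMod (2 ^ (s + 1 + i))) := by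
    rw [← Nat.cast_mul, mul_comm, ← hdv, ZMod.natCast_zmod_val]
  have hval : ∀ b : ZMod (2 ^ (s + 1 + i)),
      (b * d).val = ((b * (v : ZMod (2 ^ (s + 1 + i)))).val % 2 ^ (s + 1)) * 2 ^ i := by
    intro b
    rw [hdeq, ← mul_assoc, ← ZMod.natCast_zmod_val (b * (v : ZMod (2 ^ (s + 1 + i)))),
      ← Nat.cast_mul, ZMod.val_natCast, ZMod.natCast_zmod_val]
    generalize (b * (v : ZMod (2 ^ (s + 1 + i)))).val = z
    rw [pow_add 2 (s + 1) i, Nat.mul_mod_mul_right]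
  have hpos : ∀ b : ZMod (2 ^ (s + 1 + i)), IsUnit b →
      0 < (b * (v : ZMod (2 ^ (s + 1 + i)))).val % 2 ^ (s + 1) := by
    intro b hb
    have h1 := hb.mul hu
    rw [← ZMod.natCast_zmod_val (b * (v : ZMod (2 ^ (s + 1 + i)))), ZMod.isUnit_iff_coprime,
      Nat.coprime_pow_right_iff (by omega)] at h1
    rcases Nat.eq_zero_or_pos ((b * (v : ZMod (2 ^ (s + 1 + i)))).val % 2 ^ (s + 1)) with h | h
    · exfalso
      have h2 : 2 ∣ (b * (v : ZMod (2 ^ (s + 1 + i)))).val :=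
        (dvd_pow_self 2 (by omega)).trans (Nat.dvd_of_mod_eq_zero h)
      have := Nat.dvd_gcd h2 (dvd_refl 2)
      rw [h1] at this
      omega
    · exact h
  have hquot : ∀ b : ZMod (2 ^ (s + 1 + i)),
      (b * (v : ZMod (2 ^ (s + 1 + i)))).val / 2 ^ (s + 1) < 2 ^ i := fun b =>
    Nat.div_lt_of_lt_mul (by rw [← pow_add]; exact ZMod.val_lt _)
  have hcard : #{b : ZMod (2 ^ (s + 1 + i)) | IsUnit b ∧ S * (b * d).val < L} ≤ L / S := by
    rw [← card_range (L / S)]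
    refine card_le_card_of_injOn
      (fun b => ((b * (v : ZMod (2 ^ (s + 1 + i)))).val % 2 ^ (s + 1) - 1) * 2 ^ i
        + (b * (v : ZMod (2 ^ (s + 1 + i)))).val / 2 ^ (s + 1)) ?_ ?_
    · intro b hb
      simp only [coe_filter, mem_univ, true_and, Set.mem_ofPred_eq] at hb
      simp only [coe_range, Set.mem_Iio]
      obtain ⟨hb, hbS⟩ := hb
      rw [hval] at hbS
      have h1 := hpos b hb
      have h2 := hquot b
      generalize (b * (v : ZMod (2 ^ (s + 1 + i)))).val % 2 ^ (s + 1) = x at *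
      obtain ⟨x, rfl⟩ : ∃ x', x = x' + 1 := ⟨x - 1, by omega⟩
      rw [Nat.lt_iff_add_one_le, Nat.le_div_iff_mul_le hS]
      refine le_trans ?_ hbS.le
      rw [mul_comm S]
      gcongr
      rw [Nat.add_sub_cancel, add_mul]
      omega
    · intro b hb b' hb' h
      simp only [coe_filter, mem_univ, true_and, Set.mem_ofPred_eq] at hb hb'
      simp only at h
      have h1 := hpos b hb.1
      have h1' := hpos b' hb'.1
      have h2 := hquot b
      have h2' := hquot b'
      have h3 : (b * (v : ZMod (2 ^ (s + 1 + i)))).val % 2 ^ (s + 1) - 1 =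
          (b' * (v : ZMod (2 ^ (s + 1 + i)))).val % 2 ^ (s + 1) - 1 := by
        have := congrArg (· / 2 ^ i) h
        simpa [Nat.mul_add_div, mul_comm _ (2 ^ i), Nat.div_eq_of_lt h2, Nat.div_eq_of_lt h2']
          using this
      have h4 : (b * (v : ZMod (2 ^ (s + 1 + i)))).val / 2 ^ (s + 1) =
          (b' * (v : ZMod (2 ^ (s + 1 + i)))).val / 2 ^ (s + 1) := by
        rw [h3] at h; omega
      have h5 : (b * (v : ZMod (2 ^ (s + 1 + i)))).val =
          (b' * (v : ZMod (2 ^ (s + 1 + i)))).val := by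
        rw [← Nat.div_add_mod (b * (v : ZMod (2 ^ (s + 1 + i)))).val (2 ^ (s + 1)), h4,
          Nat.sub_one_cancel h1 h1' h3, Nat.div_add_mod]
      exact hu.mul_right_cancel (ZMod.val_injective _ h5)
  calc _ ≤ L / S * S := Nat.mul_le_mul_right _ hcard
    _ ≤ L := Nat.div_mul_le_self L S

lemma val_natCast_mul_add {r : ℕ} (w : ℕ) (b x : ZMod (2 ^ r)) :
    2 ^ r * (w * (b * x).val / 2 ^ r) + ((w : ZMod (2 ^ r)) * b * x).val = w * (b * x).val := by
  have : ((w : ZMod (2 ^ r)) * b * x).val = w * (b * x).val % 2 ^ r := by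
    rw [mul_assoc, ← ZMod.val_natCast, Nat.cast_mul, ZMod.natCast_zmod_val]
  rw [this, Nat.div_add_mod]

lemma close_of_same_tooth {r L S w : ℕ} {b x x' : ZMod (2 ^ r)} (hL : 0 < L) (hSw : S ≤ w)
    (hy : ((w : ZMod (2 ^ r)) * b * x).val / L = ((w : ZMod (2 ^ r)) * b * x').val / L)
    (hc : w * (b * x).val / 2 ^ r = w * (b * x').val / 2 ^ r)
    (hle : (b * x').val ≤ (b * x).val) : S * (b * (x - x')).val < L := by
  have h1 := val_natCast_mul_add w b x
  have h2 := val_natCast_mul_add w b x'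
  have h3 := Nat.div_add_mod ((w : ZMod (2 ^ r)) * b * x).val L
  have h4 := Nat.div_add_mod ((w : ZMod (2 ^ r)) * b * x').val L
  have h5 := Nat.mod_lt ((w : ZMod (2 ^ r)) * b * x).val hL
  have h6 := Nat.mod_lt ((w : ZMod (2 ^ r)) * b * x').val hL
  rw [mul_sub, ZMod.val_sub hle]
  calc S * ((b * x).val - (b * x').val) ≤ w * ((b * x).val - (b * x').val) := by gcongr
    _ < L := by
      rw [Nat.mul_sub, ← h1, ← h2, hc]
      rw [hy] at h3
      omega

lemma card_image_teeth_le {r M L w w' y y' : ℕ} (hLM : L * M = 2 ^ r) (hw : 0 < w)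
    (hwM : w + w' ≤ M) (b : ZMod (2 ^ r)) (Z : Finset (ZMod (2 ^ r)))
    (hy : ∀ x ∈ Z, ((w : ZMod (2 ^ r)) * b * x).val / L = y)
    (hy' : ∀ x ∈ Z, ((w' : ZMod (2 ^ r)) * b * x).val / L = y') :
    #(Z.image fun x => (w * (b * x).val / 2 ^ r, w' * (b * x).val / 2 ^ r)) ≤ Nat.gcd w w' := by
  have hL : 0 < L := Nat.pos_of_ne_zero (by rintro rfl; exact absurd hLM.symm (by simp))
  refine card_le_gcd hw _ ?_ ?_
  · intro p hp
    obtain ⟨x, _, rfl⟩ := mem_image.1 hp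
    refine Nat.div_lt_of_lt_mul ?_
    rw [mul_comm (2 ^ r)]
    exact Nat.mul_lt_mul_of_pos_left (ZMod.val_lt _) hw
  · intro p hp p' hp'
    obtain ⟨x, hx, rfl⟩ := mem_image.1 hp
    obtain ⟨z, hz, rfl⟩ := mem_image.1 hp'
    dsimp only
    have e1 := val_natCast_mul_add w b x
    have e2 := val_natCast_mul_add w b z
    have e3 := val_natCast_mul_add w' b x
    have e4 := val_natCast_mul_add w' b z
    have bd : ∀ u Y : ℕ, u / L = Y → L * Y ≤ u ∧ u < L * Y + L := by
      rintro u _ rfl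
      have := Nat.div_add_mod u L
      have := Nat.mod_lt u hL
      omega
    have b1 := bd _ _ (hy x hx)
    have b2 := bd _ _ (hy z hz)
    have b3 := bd _ _ (hy' x hx)
    have b4 := bd _ _ (hy' z hz)
    generalize ((w : ZMod (2 ^ r)) * b * x).val = ρ1 at *
    generalize ((w : ZMod (2 ^ r)) * b * z).val = ρ2 at *
    generalize ((w' : ZMod (2 ^ r)) * b * x).val = ρ3 at *
    generalize ((w' : ZMod (2 ^ r)) * b * z).val = ρ4 at *
    generalize w * (b * x).val / 2 ^ r = c1 at *
    generalize w * (b * z).val / 2 ^ r = c2 at *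
    generalize w' * (b * x).val / 2 ^ r = c3 at *
    generalize w' * (b * z).val / 2 ^ r = c4 at *
    generalize (b * x).val = β at *
    generalize (b * z).val = γ at *
    have hq : (0 : ℤ) < 2 ^ r := by positivity
    have hLM' : (L : ℤ) * M = 2 ^ r := by exact_mod_cast hLM
    have hwM' : (w : ℤ) + w' ≤ M := by exact_mod_cast hwM
    zify at e1 e2 e3 e4 b1 b2 b3 b4
    have hLz : (0 : ℤ) < L := by exact_mod_cast hL
    have hwz : (0 : ℤ) < w := by exact_mod_cast hw
    have hwz' : (0 : ℤ) ≤ w' := by positivity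
    have hmul : (L : ℤ) * (w + w') ≤ 2 ^ r := by rw [← hLM']; gcongr
    have eq : (2 ^ r : ℤ) * (w' * ((c1 : ℤ) - c2) - w * ((c3 : ℤ) - c4)) =
        w * ((ρ3 : ℤ) - ρ4) - w' * ((ρ1 : ℤ) - ρ2) := by
      linear_combination (w' : ℤ) * e1 - w' * e2 - w * e3 + w * e4
    have u1 : (w : ℤ) * ((ρ3 : ℤ) - ρ4) < w * L := by gcongr; linarith
    have u2 : (w : ℤ) * (-L) < w * ((ρ3 : ℤ) - ρ4) := by gcongr; linarith
    have u3 : (w' : ℤ) * ((ρ1 : ℤ) - ρ2) ≤ w' * L := by gcongr; linarith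
    have u4 : (w' : ℤ) * (-L) ≤ w' * ((ρ1 : ℤ) - ρ2) := by gcongr; linarith
    have lt1 : (2 ^ r : ℤ) * (w' * ((c1 : ℤ) - c2) - w * ((c3 : ℤ) - c4)) < 2 ^ r * 1 := by
      rw [eq]; linarith
    have lt2 : (2 ^ r : ℤ) * (-1) < 2 ^ r * (w' * ((c1 : ℤ) - c2) - w * ((c3 : ℤ) - c4)) := by
      rw [eq]; linarith
    have := lt_of_mul_lt_mul_left lt1 hq.le
    have := lt_of_mul_lt_mul_left lt2 hq.le
    linarith [(by omega : w' * ((c1 : ℤ) - c2) - w * ((c3 : ℤ) - c4) = 0)]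

lemma le_card_odd_Icc (T : ℕ) : T ≤ #{w ∈ Icc 1 (4 * T) | Odd w ∧ 2 * T ≤ w} := by
  calc T = #((Ico T (2 * T)).image fun v => 2 * v + 1) := by
        rw [card_image_of_injective _ fun a b h => by simpa using h, Nat.card_Ico]; omega
    _ ≤ _ := card_le_card fun w hw => by
        obtain ⟨v, hv, rfl⟩ := mem_image.1 hw
        have := mem_Ico.1 hv
        simp only [mem_filter, mem_Icc]
        exact ⟨by omega, odd_two_mul_add_one v, by omega⟩

lemma isUnit_natCast_of_odd {w : ℕ} (r : ℕ) (hw : Odd w) : IsUnit (w : ZMod (2 ^ r)) :=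
  (ZMod.isUnit_iff_coprime _ _).2 ((Nat.coprime_two_right.2 hw).pow_right r)

lemma card_mul_mem {r w : ℕ} (hw : Odd w) (B : Finset (ZMod (2 ^ r))) :
    #{b : ZMod (2 ^ r) | (w : ZMod (2 ^ r)) * b ∈ B} = #B := by
  obtain ⟨u, hu⟩ := isUnit_natCast_of_odd r hw
  refine card_bijective (fun b => (w : ZMod (2 ^ r)) * b) ?_ (by simp)
  rw [← hu]
  exact u.mulLeft_bijective

lemma card_close_le {r T L : ℕ} (hT : 0 < T) (X : Finset (ZMod (2 ^ r))) :
    #{p ∈ (univ : Finset (ZMod (2 ^ r))) ×ˢ (X ×ˢ X) | IsUnit p.1 ∧ p.2.1 ≠ p.2.2 ∧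
      (2 * T * (p.1 * (p.2.1 - p.2.2)).val < L ∨ 2 * T * (p.1 * (p.2.2 - p.2.1)).val < L)} * T
      ≤ #X ^ 2 * L := by
  have key : ∀ p ∈ X ×ˢ X, #{b : ZMod (2 ^ r) | IsUnit b ∧ p.1 ≠ p.2 ∧
      (2 * T * (b * (p.1 - p.2)).val < L ∨ 2 * T * (b * (p.2 - p.1)).val < L)} * T ≤ L := by
    rintro ⟨x, x'⟩ _
    dsimp only
    by_cases hx : x = x'
    · simp [hx]
    have h1 := card_isUnit_mul_val_lt (sub_ne_zero.2 hx) (2 * T) L (by omega)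
    have h2 := card_isUnit_mul_val_lt (sub_ne_zero.2 (Ne.symm hx)) (2 * T) L (by omega)
    have h3 : #{b : ZMod (2 ^ r) | IsUnit b ∧ x ≠ x' ∧
        (2 * T * (b * (x - x')).val < L ∨ 2 * T * (b * (x' - x)).val < L)} ≤
        #{b : ZMod (2 ^ r) | IsUnit b ∧ 2 * T * (b * (x - x')).val < L} +
        #{b : ZMod (2 ^ r) | IsUnit b ∧ 2 * T * (b * (x' - x)).val < L} := by
      refine le_trans (card_le_card fun b hb => ?_) (card_union_le _ _)
      simp only [mem_filter, mem_union, mem_univ, true_and] at hb ⊢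
      tauto
    nlinarith
  rw [card_filter, sum_product_right, sum_mul]
  simp_rw [← card_filter]
  refine (sum_le_sum key).trans ?_
  simp [sq]

/-- If every multiplier `a ∈ B` puts at least `k` points of `X` in one bucket, then dilating each
`a` to `b = a / w` for odd `w ∈ [2T, 4T]` spreads that bucket over `w` short teeth. The teeth of two
dilations `w`, `w'` of the same `b` share at most `gcd w w'` intersections, so Cauchy-Schwarz
against the number of close pairs bounds the size of `B`. -/
lemma sq_card_heavy_le {r M L k T : ℕ} (hLM : L * M = 2 ^ r) (hT : 0 < T) (hTk : 8 * T ≤ k)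
    (hkM : k ≤ M) (X B : Finset (ZMod (2 ^ r))) (hB : ∀ a ∈ B, IsUnit a)
    (Y : ZMod (2 ^ r) → Finset (ZMod (2 ^ r))) (y : ZMod (2 ^ r) → ℕ) (hYX : ∀ a, Y a ⊆ X)
    (hYy : ∀ a ∈ B, ∀ x ∈ Y a, (a * x).val / L = y a) (hYk : ∀ a ∈ B, k ≤ #(Y a)) :
    ((#B : ℝ) * T * (k / 2)) ^ 2 ≤
      (#X : ℝ) ^ 2 * L / T * (#B * ((4 * T) ^ 2 * (1 + Real.log (4 * T)))) := by
  have hL : 0 < L := Nat.pos_of_ne_zero (by rintro rfl; exact absurd hLM.symm (by simp))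
  set W := {w ∈ Icc 1 (4 * T) | Odd w ∧ 2 * T ≤ w} with hW
  have hWmem : ∀ w ∈ W, 0 < w ∧ w ≤ 4 * T ∧ Odd w ∧ 2 * T ≤ w := by
    intro w hw
    simp only [hW, mem_filter, mem_Icc] at hw
    exact ⟨by omega, by omega, hw.2.1, by omega⟩
  let c : ℕ → ZMod (2 ^ r) → ZMod (2 ^ r) → ℕ := fun w b x => w * (b * x).val / 2 ^ r
  let f : ℕ → ZMod (2 ^ r) → ZMod (2 ^ r) → ZMod (2 ^ r) → ℝ := fun w b x x' =>
    if (w : ZMod (2 ^ r)) * b ∈ B then fiberWeight (Y (w * b)) (c w b) x x' else 0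
  let F : ZMod (2 ^ r) × (ZMod (2 ^ r) × ZMod (2 ^ r)) → ℝ := fun p =>
    ∑ w ∈ W, f w p.1 p.2.1 p.2.2
  set U := (univ : Finset (ZMod (2 ^ r))) ×ˢ (X ×ˢ X) with hU
  set Ω := {p ∈ U | IsUnit p.1 ∧ p.2.1 ≠ p.2.2 ∧
      (2 * T * (p.1 * (p.2.1 - p.2.2)).val < L ∨ 2 * T * (p.1 * (p.2.2 - p.2.1)).val < L)} with hΩ
  have hsupp : ∀ p ∈ U, F p ≠ 0 → IsUnit p.1 ∧ p.2.1 ≠ p.2.2 ∧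
      (2 * T * (p.1 * (p.2.1 - p.2.2)).val < L ∨ 2 * T * (p.1 * (p.2.2 - p.2.1)).val < L) := by
    rintro ⟨b, x, x'⟩ _ hF
    obtain ⟨w, hw, hne⟩ := exists_ne_zero_of_sum_ne_zero hF
    obtain ⟨_, _, hodd, hTw⟩ := hWmem w hw
    simp only [f, fiberWeight, ne_eq, ite_eq_right_iff, Classical.not_imp] at hne
    obtain ⟨hmem, ⟨hx, hx', hxx, hc⟩, _⟩ := hne
    refine ⟨isUnit_of_mul_isUnit_right (hB _ hmem), hxx, ?_⟩
    have hyy := (hYy _ hmem x hx).trans (hYy _ hmem x' hx').symm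
    rcases le_total (b * x').val (b * x).val with h | h
    · exact Or.inl (close_of_same_tooth hL hTw hyy hc h)
    · exact Or.inr (close_of_same_tooth hL hTw hyy.symm hc.symm h)
  have hlower : (#B : ℝ) * T * (k / 2) ≤ ∑ p ∈ Ω, F p := by
    rw [hΩ, sum_filter_of_ne hsupp, hU, sum_product]
    simp_rw [sum_product]
    calc (#B : ℝ) * T * (k / 2) ≤ ∑ w ∈ W, (#B : ℝ) * (k / 2) := by
          rw [sum_const, nsmul_eq_mul]
          have : (T : ℝ) ≤ #W := by exact_mod_cast le_card_odd_Icc T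
          calc (#B : ℝ) * T * (k / 2) = T * (#B * (k / 2)) := by ring
            _ ≤ _ := by gcongr
      _ ≤ ∑ w ∈ W, ∑ b, ∑ x ∈ X, ∑ x' ∈ X, f w b x x' := by
          refine sum_le_sum fun w hw => ?_
          obtain ⟨hw0, hwT, hodd, _⟩ := hWmem w hw
          calc (#B : ℝ) * (k / 2) =
              ∑ b : ZMod (2 ^ r), if (w : ZMod (2 ^ r)) * b ∈ B then (k / 2 : ℝ) else 0 := by
                rw [← sum_filter, sum_const, card_mul_mem hodd, nsmul_eq_mul]
            _ ≤ _ := by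
                refine sum_le_sum fun b _ => ?_
                simp only [f]
                split_ifs with hb
                · have h1 := le_sum_fiberWeight (hYX (w * b)) (c := c w b) (w := w)
                    fun x _ => Nat.div_lt_of_lt_mul (by
                      rw [mul_comm (2 ^ r)]
                      exact Nat.mul_lt_mul_of_pos_left (ZMod.val_lt _) hw0)
                  have h2 : (k : ℝ) ≤ #(Y (w * b)) := by exact_mod_cast hYk _ hb
                  have h3 : (w : ℝ) ≤ 4 * T := by exact_mod_cast hwT
                  have h4 : (8 : ℝ) * T ≤ k := by exact_mod_cast hTk
                  linarith
                · simp
      _ = _ := by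
          rw [sum_comm]
          refine sum_congr rfl fun b _ => ?_
          rw [sum_comm]
          refine sum_congr rfl fun x _ => ?_
          rw [sum_comm]
  have hupper : ∑ p ∈ Ω, F p ^ 2 ≤ #B * ((4 * T) ^ 2 * (1 + Real.log (4 * T))) := by
    calc ∑ p ∈ Ω, F p ^ 2 ≤ ∑ p ∈ U, F p ^ 2 :=
          sum_le_sum_of_subset_of_nonneg (filter_subset _ _) fun _ _ _ => sq_nonneg _
      _ = ∑ w ∈ W, ∑ w' ∈ W, ∑ b, ∑ x ∈ X, ∑ x' ∈ X, f w b x x' * f w' b x x' := by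
          simp_rw [F, sq, sum_mul_sum]
          rw [sum_comm]
          refine sum_congr rfl fun w _ => ?_
          rw [sum_comm]
          refine sum_congr rfl fun w' _ => ?_
          rw [hU, sum_product]
          simp_rw [sum_product]
      _ ≤ ∑ w ∈ W, ∑ w' ∈ W, (#B : ℝ) * Nat.gcd w w' := by
          refine sum_le_sum fun w hw => sum_le_sum fun w' hw' => ?_
          obtain ⟨hw0, hwT, hodd, _⟩ := hWmem w hw
          obtain ⟨hw0', hwT', hodd', _⟩ := hWmem w' hw'
          calc _ ≤ ∑ b : ZMod (2 ^ r),
                if (w : ZMod (2 ^ r)) * b ∈ B then (Nat.gcd w w' : ℝ) else 0 := by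
                refine sum_le_sum fun b _ => ?_
                simp only [f]
                split_ifs with hb hb'
                · refine (sum_fiberWeight_mul_le X _ _ _ _).trans ?_
                  exact_mod_cast card_image_teeth_le hLM hw0 (by omega) b _
                    (fun x hx => hYy _ hb x (mem_inter.1 hx).1)
                    (fun x hx => hYy _ hb' x (mem_inter.1 hx).2)
                · simp
                · simp
                · simp
            _ = _ := by
                rw [← sum_filter, sum_const, card_mul_mem hodd, nsmul_eq_mul]
      _ = #B * ∑ w ∈ W, ∑ w' ∈ W, (Nat.gcd w w' : ℝ) := by simp_rw [mul_sum]
      _ ≤ #B * ∑ w ∈ Icc 1 (4 * T), ∑ w' ∈ Icc 1 (4 * T), (Nat.gcd w w' : ℝ) := by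
          gcongr
          refine (sum_le_sum fun w _ => sum_le_sum_of_subset_of_nonneg (filter_subset _ _)
            fun _ _ _ => by positivity).trans ?_
          exact sum_le_sum_of_subset_of_nonneg (filter_subset _ _) fun _ _ _ => by positivity
      _ ≤ _ := by
          have := sum_gcd_le (4 * T)
          push_cast at this
          gcongr
  have hcard : (#Ω : ℝ) ≤ (#X : ℝ) ^ 2 * L / T := by
    rw [le_div_iff₀ (by exact_mod_cast hT)]
    exact_mod_cast card_close_le hT X
  calc ((#B : ℝ) * T * (k / 2)) ^ 2 ≤ (∑ p ∈ Ω, F p) ^ 2 := by gcongr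
    _ ≤ #Ω * ∑ p ∈ Ω, F p ^ 2 := sq_sum_le_card_mul_sum_sq
    _ ≤ _ := by
      gcongr

lemma two_pow_le_two_mul_card_odd {r : ℕ} (hr : 0 < r) :
    2 ^ r ≤ 2 * #{a : ZMod (2 ^ r) | a.val % 2 = 1} := by
  obtain ⟨s, rfl⟩ : ∃ s, r = s + 1 := ⟨r - 1, by omega⟩
  have hval : ∀ i < 2 ^ s, ((2 * i + 1 : ℕ) : ZMod (2 ^ (s + 1))).val = 2 * i + 1 := fun i hi =>
    ZMod.val_natCast_of_lt (by rw [pow_succ]; omega)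
  have : #(range (2 ^ s)) ≤ #{a : ZMod (2 ^ (s + 1)) | a.val % 2 = 1} := by
    refine card_le_card_of_injOn (fun i => ((2 * i + 1 : ℕ) : ZMod (2 ^ (s + 1)))) ?_ ?_
    · intro i hi
      have hi : i < 2 ^ s := by simpa using hi
      simp only [coe_filter, mem_univ, true_and, Set.mem_ofPred_eq]
      rw [hval i hi]; omega
    · intro i hi j hj h
      have hi : i < 2 ^ s := by simpa using hi
      have hj : j < 2 ^ s := by simpa using hj
      have := congrArg ZMod.val h
      simp only at this
      rw [hval i hi, hval j hj] at this
      omega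
  rw [card_range] at this
  have := pow_succ 2 s
  omega

lemma isUnit_of_val_odd {r : ℕ} {a : ZMod (2 ^ r)} (ha : a.val % 2 = 1) : IsUnit a := by
  rw [← ZMod.natCast_zmod_val a]
  exact isUnit_natCast_of_odd r (Nat.odd_iff.2 ha)

lemma card_heavy_le {r M L k : ℕ} (hr : 0 < r) (hLM : L * M = 2 ^ r) (hk : 8 ≤ k)
    (X B : Finset (ZMod (2 ^ r))) (hX : 2 ≤ #X) (hXM : #X ≤ M)
    (hB : B ⊆ ({a : ZMod (2 ^ r) | a.val % 2 = 1} : Finset _))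
    (Y : ZMod (2 ^ r) → Finset (ZMod (2 ^ r))) (y : ZMod (2 ^ r) → ℕ) (hYX : ∀ a, Y a ⊆ X)
    (hYy : ∀ a ∈ B, ∀ x ∈ Y a, (a * x).val / L = y a) (hYk : ∀ a ∈ B, k ≤ #(Y a)) :
    (#B : ℝ) ≤ 6144 * (#X * Real.log #X) * #{a : ZMod (2 ^ r) | a.val % 2 = 1} *
      ((k : ℝ) ^ 3)⁻¹ := by
  have hlog : 0.69 ≤ Real.log #X :=
    (by linarith [Real.log_two_gt_d9] : (0.69 : ℝ) ≤ Real.log 2).trans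
      (Real.log_le_log (by norm_num) (by exact_mod_cast hX))
  rcases B.eq_empty_or_nonempty with rfl | ⟨a, ha⟩
  · simp only [card_empty, Nat.cast_zero]
    have : 0 ≤ Real.log #X := by linarith
    positivity
  have hkX : k ≤ #X := (hYk a ha).trans (card_le_card (hYX a))
  have hBpos : (0 : ℝ) < #B := by exact_mod_cast card_pos.2 ⟨a, ha⟩
  obtain ⟨T, hT, hTk, hkT⟩ : ∃ T : ℕ, 0 < T ∧ 8 * T ≤ k ∧ k ≤ 16 * T := ⟨k / 8, by omega⟩
  have main := sq_card_heavy_le hLM hT hTk (hkX.trans hXM) X B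
    (fun a ha => isUnit_of_val_odd (by simpa using hB ha)) Y y hYX hYy hYk
  have hT' : (0 : ℝ) < T := by exact_mod_cast hT
  have hk' : (0 : ℝ) < k := by exact_mod_cast (by omega : 0 < k)
  have hX' : (0 : ℝ) < #X := by exact_mod_cast (by omega : 0 < #X)
  have hkT' : (k : ℝ) ≤ 16 * T := by exact_mod_cast hkT
  set A : ℝ := ((#{a : ZMod (2 ^ r) | a.val % 2 = 1} : ℕ) : ℝ) with hA
  have hXL : (#X : ℝ) * L ≤ 2 * A := by
    have h1 : #X * L ≤ 2 ^ r := by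
      calc #X * L ≤ M * L := by gcongr
        _ = 2 ^ r := by rw [mul_comm, hLM]
    have := h1.trans (two_pow_le_two_mul_card_odd hr)
    rw [hA]
    exact_mod_cast this
  have hlogT : 1 + Real.log (4 * T) ≤ 3 * Real.log #X := by
    have : Real.log (4 * T) ≤ Real.log #X :=
      Real.log_le_log (by positivity) (by exact_mod_cast (by omega : 4 * T ≤ #X))
    linarith
  set l := Real.log #X with hl
  have hl0 : 0 < l := by linarith
  have hA0 : 0 ≤ A := by positivity
  have step : (#B : ℝ) * (#B * T ^ 2 * k ^ 2 / 4) ≤ #B * (96 * #X * l * A * T) := by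
    calc (#B : ℝ) * (#B * T ^ 2 * k ^ 2 / 4) = (#B * T * (k / 2)) ^ 2 := by ring
      _ ≤ _ := main
      _ ≤ (#X : ℝ) ^ 2 * L / T * (#B * ((4 * T) ^ 2 * (3 * l))) := by gcongr
      _ = #B * (48 * #X * l * (#X * L) * T) := by field_simp; ring
      _ ≤ #B * (48 * #X * l * (2 * A) * T) := by gcongr
      _ = _ := by ring
  have step2 := le_of_mul_le_mul_left step hBpos
  have step3 : (#B : ℝ) * T * k ^ 2 ≤ 384 * #X * l * A := by
    refine le_of_mul_le_mul_right ?_ hT'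
    linarith
  rw [← div_eq_mul_inv, le_div_iff₀ (by positivity)]
  calc (#B : ℝ) * (k : ℝ) ^ 3 = #B * k * (k : ℝ) ^ 2 := by ring
    _ ≤ #B * (16 * T) * (k : ℝ) ^ 2 := by gcongr
    _ = 16 * (#B * T * (k : ℝ) ^ 2) := by ring
    _ ≤ 16 * (384 * #X * l * A) := by gcongr
    _ = _ := by ring

lemma sum_le_of_card_le {α : Type*} (A : Finset α) (f : α → ℕ) {n K : ℕ} {D : ℝ} (hK : 0 < K)
    (hD : 0 ≤ D) (hfn : ∀ a ∈ A, f a ≤ n)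
    (h : ∀ k, K < k → (#{a ∈ A | k ≤ f a} : ℝ) ≤ D * #A * ((k : ℝ) ^ 3)⁻¹) :
    ∑ a ∈ A, (f a : ℝ) ≤ #A * (K + D / K ^ 2) := by
  have hK' : (0 : ℝ) < K := by exact_mod_cast hK
  have h1 : ∀ a ∈ A, (f a : ℝ) ≤ K + ∑ k ∈ Ioc K n, if k ≤ f a then (1 : ℝ) else 0 := by
    intro a ha
    have : f a - K ≤ #{k ∈ Ioc K n | k ≤ f a} := by
      rw [← Nat.card_Ioc]
      refine card_le_card fun k hk => ?_
      have := mem_Ioc.1 hk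
      have := hfn a ha
      simp only [mem_filter, mem_Ioc]; omega
    have h2 : f a ≤ K + #{k ∈ Ioc K n | k ≤ f a} := by omega
    rw [← sum_filter, sum_const, nsmul_eq_mul, mul_one]
    exact_mod_cast h2
  have h3 : ∑ k ∈ Ioc K n, (((k : ℝ)) ^ 2)⁻¹ ≤ (K : ℝ)⁻¹ := by
    rcases le_total K n with hKn | hKn
    · exact (sum_Ioc_inv_sq_le_sub hK.ne' hKn).trans (sub_le_self _ (by positivity))
    · rw [Ioc_eq_empty_of_le hKn, sum_empty]; positivity
  calc ∑ a ∈ A, (f a : ℝ)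
      ≤ ∑ a ∈ A, (K + ∑ k ∈ Ioc K n, if k ≤ f a then (1 : ℝ) else 0) := sum_le_sum h1
    _ = #A * K + ∑ k ∈ Ioc K n, (#{a ∈ A | k ≤ f a} : ℝ) := by
        rw [sum_add_distrib, sum_const, nsmul_eq_mul, sum_comm]
        simp
    _ ≤ #A * K + ∑ k ∈ Ioc K n, D * #A * (K : ℝ)⁻¹ * ((k : ℝ) ^ 2)⁻¹ := by
        gcongr with k hk
        have hk := (mem_Ioc.1 hk).1
        have hk' : (K : ℝ) ≤ k := by exact_mod_cast hk.le
        have hk0 : (0 : ℝ) < k := hK'.trans_le hk'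
        refine (h k hk).trans ?_
        rw [mul_assoc (D * #A), ← mul_inv]
        gcongr
        calc (K : ℝ) * (k : ℝ) ^ 2 ≤ k * (k : ℝ) ^ 2 := by gcongr
          _ = (k : ℝ) ^ 3 := by ring
    _ ≤ #A * K + D * #A * (K : ℝ)⁻¹ * (K : ℝ)⁻¹ := by
        rw [← mul_sum]; gcongr
    _ = _ := by field_simp

/-- **Expected longest chain for the multiply-shift hash function.**
Let `q = 2^r`, `m = 2^ℓ`, `q ≥ m ≥ n ≥ 2`, and `X ⊆ Z_q` with `|X| = n`. For `a`
uniform among the odd residues of `Z_q`, with `h(x) = ⌊lift_q (a·x) · m / q⌋` and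
`M = max_{y < m} |{x ∈ X : h x = y}|`, we have `E[M] ≤ C · (n · log n)^(1/3)`
for an absolute constant `C`. -/
theorem expected_max_chain_multiply_shift :
    ∃ C : ℝ, 0 < C ∧
      ∀ (n ℓ r : ℕ), 0 < ℓ → 0 < r → ℓ ≤ r → 2 ≤ n → n ≤ 2 ^ ℓ →
        ∀ X : Finset (ZMod (2 ^ r)), X.card = n →
          (∑ a ∈ Finset.univ.filter (fun a : ZMod (2 ^ r) => ZMod.val a % 2 = 1),
              (((Finset.range (2 ^ ℓ)).sup (fun y =>
                (X.filter fun x => ZMod.val (a * x) * 2 ^ ℓ / 2 ^ r = y).card) : ℕ) : ℝ))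
            / ((Finset.univ.filter (fun a : ZMod (2 ^ r) => ZMod.val a % 2 = 1)).card : ℝ)
          ≤ C * ((n : ℝ) * Real.log n) ^ ((1 : ℝ) / 3) := by
  refine ⟨105, by norm_num, fun n ℓ r _ hr hℓr hn hnℓ X hX => ?_⟩
  subst hX
  set A := Finset.univ.filter (fun a : ZMod (2 ^ r) => ZMod.val a % 2 = 1) with hA
  set f : ZMod (2 ^ r) → ℕ := fun a => (Finset.range (2 ^ ℓ)).sup (fun y =>
    (X.filter fun x => ZMod.val (a * x) * 2 ^ ℓ / 2 ^ r = y).card) with hf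
  have hLM : 2 ^ (r - ℓ) * 2 ^ ℓ = 2 ^ r := by rw [← pow_add]; congr 1; omega
  have hdiv : ∀ v : ℕ, v * 2 ^ ℓ / 2 ^ r = v / 2 ^ (r - ℓ) := fun v => by
    rw [← hLM, Nat.mul_div_mul_right _ _ (by positivity)]
  have hmax : ∀ a, ∃ y, f a = #(X.filter fun x => ZMod.val (a * x) * 2 ^ ℓ / 2 ^ r = y) := by
    intro a
    obtain ⟨y, _, hy⟩ := Finset.exists_mem_eq_sup (Finset.range (2 ^ ℓ))
      ⟨0, Finset.mem_range.2 (by positivity)⟩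
      (fun y => (X.filter fun x => ZMod.val (a * x) * 2 ^ ℓ / 2 ^ r = y).card)
    exact ⟨y, hy⟩
  choose y hy using hmax
  have hApos : (0 : ℝ) < #A := by
    have h1 : 2 ^ r ≤ 2 * #A := two_pow_le_two_mul_card_odd hr
    have h2 : 0 < 2 ^ r := by positivity
    exact_mod_cast (by omega : 0 < #A)
  have hn' : (2 : ℝ) ≤ #X := by exact_mod_cast hn
  have hlog : 0.69 ≤ Real.log #X :=
    (by linarith [Real.log_two_gt_d9] : (0.69 : ℝ) ≤ Real.log 2).trans
      (Real.log_le_log (by norm_num) hn')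
  set Z := ((#X : ℝ) * Real.log #X) ^ ((1 : ℝ) / 3) with hZ
  have hZ1 : 1 ≤ Z := Real.one_le_rpow (by nlinarith) (by norm_num)
  have hZ3 : Z ^ 3 = #X * Real.log #X := by
    rw [hZ, ← Real.rpow_natCast, ← Real.rpow_mul (by nlinarith)]
    norm_num
  have hK8 : 8 * Z ≤ (⌈8 * Z⌉₊ : ℝ) := Nat.le_ceil _
  have hK9 : (⌈8 * Z⌉₊ : ℝ) ≤ 9 * Z := by
    have := Nat.ceil_lt_add_one (by positivity : 0 ≤ 8 * Z)
    linarith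
  set K := ⌈8 * Z⌉₊ with hK
  have hK0 : 8 ≤ K := by
    have : (8 : ℝ) ≤ K := by linarith
    exact_mod_cast this
  have key := sum_le_of_card_le A f (n := #X) (K := K) (D := 6144 * (#X * Real.log #X))
    (by omega) (by rw [← hZ3]; positivity)
    (fun a _ => by rw [hy a]; exact card_le_card (filter_subset _ _))
    (fun k hk => card_heavy_le hr hLM (by omega) X _ hn hnℓ (filter_subset _ _)
      (fun a => X.filter fun x => ZMod.val (a * x) * 2 ^ ℓ / 2 ^ r = y a) y
      (fun a => filter_subset _ _)
      (fun a _ x hx => by rw [← hdiv]; exact (mem_filter.1 hx).2)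
      (fun a ha => by rw [← hy a]; exact (mem_filter.1 ha).2))
  rw [div_le_iff₀ hApos, mul_comm (105 * Z)]
  refine key.trans ?_
  gcongr
  have hKpos : (0 : ℝ) < K := by linarith
  have : 6144 * (#X * Real.log #X) / (K : ℝ) ^ 2 ≤ 96 * Z := by
    rw [← hZ3, div_le_iff₀ (by positivity)]
    calc 6144 * Z ^ 3 = 96 * Z * (8 * Z) ^ 2 := by ring
      _ ≤ 96 * Z * (K : ℝ) ^ 2 := by gcongr
  linarith
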